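/- Let (E,H,(·|·)) be an extended affine Lie algebra over a field k of characteristic 0 with core E_c. Then E_c is stable under every automorphism of the Lie algebra E: for every Lie algebra automorphism f of E, f(E_c) = E_c. -/

import Mathlib

/-! Statement 9: the core of an EALA is invariant under all Lie algebra automorphisms. -/

section EALA

variable {k E : Type*} [Field k] [CharZero k] [LieRing E] [LieAlgebra k E]

/-- The weight space of the toral subalgebra `H` for the weight `α ∈ H*`:
`E_α = {e ∈ E : [h,e] = α(h)e for all h ∈ H}`. -/
def wtSpace (H : LieSubalgebra k E) (α : Module.Dual k H) : Submodule k E where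
  carrier := {e | ∀ h : H, ⁅(h : E), e⁆ = α h • e}
  add_mem' := by
    intro a b ha hb h
    simp only [lie_add, ha h, hb h, smul_add]
  zero_mem' := by
    intro h
    simp
  smul_mem' := by
    intro c a ha h
    rw [lie_smul, ha h, smul_comm]

/-- The set of roots `Ψ` of `(E,H)`: those `α ∈ H*` with `E_α ≠ 0` (note `0 ∈ Ψ`). -/
def rootSet (H : LieSubalgebra k E) : Set (Module.Dual k H) :=
  {α | wtSpace H α ≠ ⊥}

variable (B : E →ₗ[k] E →ₗ[k] k)

/-- The representatives `t_α ∈ H` of `α ∈ H*` under the form: `(t_α | h) = α(h)` for `h ∈ H`. -/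
def reps (H : LieSubalgebra k E) (α : Module.Dual k H) : Set H :=
  {t | ∀ h : H, B (t : E) (h : E) = α h}

/-- The anisotropic roots: `Ψ^an = {α ∈ Ψ : (α|α) ≠ 0}`. -/
def anisoRootSet (H : LieSubalgebra k E) : Set (Module.Dual k H) :=
  {α | α ∈ rootSet H ∧ ∃ t ∈ reps B H α, B (t : E) (t : E) ≠ 0}

/-- The isotropic (null) roots: `Ψ⁰ = {α ∈ Ψ : (α|α) = 0}`. -/
def isoRootSet (H : LieSubalgebra k E) : Set (Module.Dual k H) :=
  {α | α ∈ rootSet H ∧ ∃ t ∈ reps B H α, B (t : E) (t : E) = 0}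

/-- The core `E_c` of `(E, H, (·|·))`: the subalgebra of `E` generated by
`⋃_{α ∈ Ψ^an} E_α`. -/
def core (H : LieSubalgebra k E) : LieSubalgebra k E :=
  LieSubalgebra.lieSpan k E (⋃ α ∈ anisoRootSet B H, (wtSpace H α : Set E))

/-- An extended affine Lie algebra structure `(E, H, (·|·))` (paper §2.3):
axioms (EA1)–(EA5), together with the requirements that the bilinear form is
nondegenerate, symmetric and invariant. -/
structure IsEALA (H : LieSubalgebra k E) : Prop where
  /-- the form is symmetric -/
  symm : ∀ x y : E, B x y = B y x
  /-- the form is invariant -/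
  invariant : ∀ x y z : E, B ⁅x, y⁆ z = B x ⁅y, z⁆
  /-- the form is nondegenerate -/
  nondeg : ∀ x : E, (∀ y : E, B x y = 0) → x = 0
  /-- (EA1): `H` is nontrivial … -/
  H_ne_bot : H ≠ ⊥
  /-- … finite-dimensional … -/
  H_fd : FiniteDimensional k H
  /-- … self-centralizing (in particular abelian): `E_0 = H` … -/
  self_centralizing : wtSpace H 0 = H.toSubmodule
  /-- … and toral: `E = ⊕_{α ∈ H*} E_α` -/
  toral : (⨆ α : Module.Dual k H, wtSpace H α) = ⊤
  /-- the restriction of the form to `H × H` is nondegenerate -/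
  H_nondeg : ∀ t : H, (∀ h : H, B (t : E) (h : E) = 0) → t = 0
  /-- (EA2): `ad x` is locally nilpotent for `x ∈ E_α`, `α ∈ Ψ^an` -/
  ea2 : ∀ α ∈ anisoRootSet B H, ∀ x ∈ wtSpace H α, ∀ e : E,
    ∃ N : ℕ, (fun y => ⁅x, y⁆)^[N] e = 0
  /-- (EA3): `Ψ^an` is connected -/
  ea3 : ∀ Ψ₁ Ψ₂ : Set (Module.Dual k H), anisoRootSet B H = Ψ₁ ∪ Ψ₂ →
    Ψ₁.Nonempty → Ψ₂.Nonempty →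
    ∃ α ∈ Ψ₁, ∃ β ∈ Ψ₂, ∃ t ∈ reps B H α, ∃ s ∈ reps B H β, B (t : E) (s : E) ≠ 0
  /-- (EA4): the centralizer of the core is contained in the core -/
  ea4 : ∀ e : E, (∀ x ∈ core B H, ⁅e, x⁆ = 0) → e ∈ core B H
  /-- (EA5): the subgroup of `(H*,+)` generated by `Ψ⁰` is free abelian of finite rank -/
  ea5 : ∃ n : ℕ, Nonempty ((AddSubgroup.closure (isoRootSet B H)) ≃+ (Fin n → ℤ))

end EALA

section RootSpaces

variable {k E : Type*} [Field k] [LieRing E] [LieAlgebra k E]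

theorem mem_rootSet_of_mem_wtSpace {H : LieSubalgebra k E} {α : Module.Dual k H} {x : E}
    (hx : x ∈ wtSpace H α) (hx0 : x ≠ 0) : α ∈ rootSet H := fun hbot =>
  hx0 (by rw [hbot] at hx; simpa using hx)

theorem exists_ne_zero_of_mem_rootSet {H : LieSubalgebra k E} {α : Module.Dual k H}
    (hα : α ∈ rootSet H) : ∃ x ∈ wtSpace H α, x ≠ 0 :=
  Submodule.exists_mem_ne_zero_of_ne_bot hα

theorem lie_mem_wtSpace_add {H : LieSubalgebra k E} {α β : Module.Dual k H} {x y : E}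
    (hx : x ∈ wtSpace H α) (hy : y ∈ wtSpace H β) : ⁅x, y⁆ ∈ wtSpace H (α + β) := by
  intro h
  rw [leibniz_lie, hx h, hy h, smul_lie, lie_smul, LinearMap.add_apply, add_smul]

theorem toEnd_pow_mem_wtSpace {H : LieSubalgebra k E} {α β : Module.Dual k H} {x y : E}
    (hx : x ∈ wtSpace H α) (hy : y ∈ wtSpace H β) (n : ℕ) :
    (LieModule.toEnd k E E x ^ n) y ∈ wtSpace H (n • α + β) := by
  induction n with
  | zero => simpa using hy
  | succ n ih =>
    rw [pow_succ', Module.End.mul_apply, LieModule.toEnd_apply_apply, succ_nsmul', add_assoc]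
    exact lie_mem_wtSpace_add hx ih

/-- An ideal contains every homogeneous component of each of its elements. -/
theorem mem_of_sum_wtSpace_mem {H : LieSubalgebra k E} (I : LieIdeal k E)
    (s : Finset (Module.Dual k H)) (x : Module.Dual k H → E)
    (hx : ∀ α ∈ s, x α ∈ wtSpace H α) (hsum : ∑ α ∈ s, x α ∈ I) : ∀ α ∈ s, x α ∈ I := by
  classical
  induction s using Finset.induction_on generalizing x with
  | empty => simp
  | insert β s hβ ih =>
    have key : ∀ α ∈ s, x α ∈ I := by
      intro α hα
      obtain ⟨h, hh⟩ : ∃ h : H, α h ≠ β h := by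
        by_contra! hc
        exact hβ (LinearMap.ext hc ▸ hα)
      have h1 : ∑ γ ∈ s, (γ h - β h) • x γ ∈ I := by
        have h2 : ⁅(h : E), ∑ γ ∈ insert β s, x γ⁆ - β h • ∑ γ ∈ insert β s, x γ ∈ I :=
          I.sub_mem (lie_mem_right k E I _ _ hsum) (I.smul_mem _ hsum)
        convert h2 using 1
        rw [lie_sum, Finset.smul_sum, ← Finset.sum_sub_distrib, Finset.sum_insert hβ,
          hx β (Finset.mem_insert_self _ _) h, sub_self, zero_add]
        refine Finset.sum_congr rfl fun γ hγ => ?_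
        rw [hx γ (Finset.mem_insert_of_mem hγ) h, sub_smul]
      have h3 := ih (fun γ => (γ h - β h) • x γ)
        (fun γ hγ => Submodule.smul_mem _ _ (hx γ (Finset.mem_insert_of_mem hγ))) h1 α hα
      have h4 := I.smul_mem (α h - β h)⁻¹ h3
      rwa [smul_smul, inv_mul_cancel₀ (sub_ne_zero.mpr hh), one_smul] at h4
    rw [Finset.sum_insert hβ] at hsum
    have hxβ : x β ∈ I := by
      have := I.sub_mem hsum (I.toSubmodule.sum_mem key)
      rwa [add_sub_cancel_right] at this
    intro α hα
    rcases Finset.mem_insert.mp hα with rfl | hα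
    · exact hxβ
    · exact key α hα

end RootSpaces

theorem Module.End.exists_pow_apply_ne_zero_and_succ_eq_zero {k V : Type*} [Field k]
    [AddCommGroup V] [Module k V] (T : Module.End k V) {v : V} (hv : v ≠ 0)
    (hT : ∃ N : ℕ, (T ^ N) v = 0) : ∃ n : ℕ, (T ^ n) v ≠ 0 ∧ (T ^ (n + 1)) v = 0 := by
  by_contra! hc
  obtain ⟨N, hN⟩ := hT
  have : ∀ n : ℕ, (T ^ n) v ≠ 0 := fun n => by
    induction n with
    | zero => simpa using hv
    | succ n ih => exact hc n ih
  exact this N hN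

section Heisenberg

variable {k V : Type*} [Field k] [CharZero k] [AddCommGroup V] [Module k V]

/-- In a representation of the Heisenberg algebra `[x, y] = d` with nonzero central charge, a
vector killed by `y` generates a free module over `k[x]`. -/
theorem heisenberg_pow_apply_ne_zero (x y d : Module.End k V) (hxy : x * y - y * x = d)
    (hxd : Commute x d) {c : k} (hc : c ≠ 0) {w : V} (hw : w ≠ 0) (hyw : y w = 0)
    (hdw : d w = c • w) (n : ℕ) : (x ^ n) w ≠ 0 := by
  have hyx : ∀ v, y (x v) = x (y v) - d v := fun v => by simp [← hxy]
  have hd : ∀ n : ℕ, d ((x ^ n) w) = c • (x ^ n) w := fun n => by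
    rw [← Module.End.mul_apply, ← (hxd.pow_left n).eq, Module.End.mul_apply, hdw, map_smul]
  have key : ∀ n : ℕ, y ((x ^ (n + 1)) w) = (-((n + 1 : ℕ) : k) * c) • (x ^ n) w := by
    intro n
    induction n with
    | zero => simp [hyx, hyw, hdw]
    | succ n ih =>
      rw [pow_succ' x (n + 1), Module.End.mul_apply, hyx, ih, hd, map_smul,
        ← Module.End.mul_apply, ← pow_succ', ← sub_smul]
      congr 1
      push_cast
      ring
  induction n with
  | zero => simpa using hw
  | succ n ih =>
    intro h0
    have h1 := key n
    rw [h0, map_zero, eq_comm, smul_eq_zero] at h1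
    rcases h1 with h1 | h1
    · rcases mul_eq_zero.mp h1 with h1 | h1
      · exact Nat.cast_ne_zero.mpr n.succ_ne_zero (neg_eq_zero.mp h1)
      · exact hc h1
    · exact ih h1

end Heisenberg

namespace IsEALA

variable {k E : Type*} [Field k] [LieRing E] [LieAlgebra k E]
  {B : E →ₗ[k] E →ₗ[k] k} {H : LieSubalgebra k E}

theorem form_eq_zero (h : IsEALA B H) {α β : Module.Dual k H} {x y : E}
    (hx : x ∈ wtSpace H α) (hy : y ∈ wtSpace H β) (hαβ : α + β ≠ 0) : B x y = 0 := by
  obtain ⟨t, ht⟩ : ∃ t : H, (α + β) t ≠ 0 := by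
    by_contra! hc
    exact hαβ (LinearMap.ext hc)
  have h1 : α t * B x y = -(β t * B x y) := by
    have := h.invariant x t y
    rw [← lie_skew, hx t, hy t] at this
    simpa [neg_eq_iff_eq_neg] using this
  have h2 : (α + β) t * B x y = 0 := by
    rw [LinearMap.add_apply, add_mul, h1, neg_add_cancel]
  exact (mul_eq_zero.mp h2).resolve_left ht

theorem exists_form_eq_one (h : IsEALA B H) {α : Module.Dual k H} {x : E}
    (hx : x ∈ wtSpace H α) (hx0 : x ≠ 0) : ∃ y ∈ wtSpace H (-α), B x y = 1 := by
  obtain ⟨y, hy, hxy⟩ : ∃ y ∈ wtSpace H (-α), B x y ≠ 0 := by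
    by_contra! hc
    refine hx0 (h.nondeg x fun y => ?_)
    have hy : y ∈ ⨆ β : Module.Dual k H, wtSpace H β := h.toral ▸ Submodule.mem_top
    induction hy using Submodule.iSup_induction' with
    | mem β y hy =>
      by_cases hβ : α + β = 0
      · exact hc y (neg_eq_of_add_eq_zero_right hβ ▸ hy)
      · exact h.form_eq_zero hx hy hβ
    | zero => simp
    | add y z _ _ hy hz => rw [map_add, hy, hz, add_zero]
  refine ⟨(B x y)⁻¹ • y, Submodule.smul_mem _ _ hy, ?_⟩
  rw [map_smul, smul_eq_mul, inv_mul_cancel₀ hxy]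

theorem eq_of_mem_reps (h : IsEALA B H) {α : Module.Dual k H} {s t : H}
    (hs : s ∈ reps B H α) (ht : t ∈ reps B H α) : s = t := by
  refine sub_eq_zero.mp (h.H_nondeg _ fun u => ?_)
  have := (hs u).trans (ht u).symm
  simpa [sub_eq_zero] using this

theorem apply_eq_apply (h : IsEALA B H) {α β : Module.Dual k H} {s t : H}
    (hs : s ∈ reps B H α) (ht : t ∈ reps B H β) : β s = α t := by
  rw [← hs t, ← ht s, h.symm]

theorem lie_mem_reps (h : IsEALA B H) {α : Module.Dual k H} {x y : E}
    (hx : x ∈ wtSpace H α) (hy : y ∈ wtSpace H (-α)) (hxy : B x y = 1) :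
    ∃ t ∈ reps B H α, (t : E) = ⁅x, y⁆ := by
  have h0 : ⁅x, y⁆ ∈ H := by
    have := lie_mem_wtSpace_add hx hy
    rw [add_neg_cancel, h.self_centralizing] at this
    exact this
  refine ⟨⟨⁅x, y⁆, h0⟩, fun u => ?_, rfl⟩
  rw [h.invariant, ← lie_skew, hy u]
  simp [hxy]

theorem lie_eq_of_mem_reps (h : IsEALA B H) {α : Module.Dual k H} {x y : E}
    (hx : x ∈ wtSpace H α) (hy : y ∈ wtSpace H (-α)) (hxy : B x y = 1) {t : H}
    (ht : t ∈ reps B H α) : ⁅x, y⁆ = t := by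
  obtain ⟨s, hs, hs'⟩ := h.lie_mem_reps hx hy hxy
  rw [← hs', h.eq_of_mem_reps hs ht]

theorem exists_mem_reps (h : IsEALA B H) {α : Module.Dual k H} (hα : α ∈ rootSet H) :
    ∃ t, t ∈ reps B H α := by
  obtain ⟨x, hx, hx0⟩ := exists_ne_zero_of_mem_rootSet hα
  obtain ⟨y, hy, hxy⟩ := h.exists_form_eq_one hx hx0
  obtain ⟨t, ht, -⟩ := h.lie_mem_reps hx hy hxy
  exact ⟨t, ht⟩

theorem add_mem_reps {α β : Module.Dual k H} {s t : H}
    (hs : s ∈ reps B H α) (ht : t ∈ reps B H β) : s + t ∈ reps B H (α + β) := fun u => by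
  simp [hs u, ht u]

theorem zsmul_mem_reps {α : Module.Dual k H} {t : H} (ht : t ∈ reps B H α) (n : ℤ) :
    n • t ∈ reps B H (n • α) := fun u => by
  simp [ht u]

theorem neg_mem_anisoRootSet (h : IsEALA B H) {α : Module.Dual k H}
    (hα : α ∈ anisoRootSet B H) : -α ∈ anisoRootSet B H := by
  obtain ⟨hr, t, ht, htt⟩ := hα
  obtain ⟨x, hx, hx0⟩ := exists_ne_zero_of_mem_rootSet hr
  obtain ⟨y, hy, hxy⟩ := h.exists_form_eq_one hx hx0
  refine ⟨mem_rootSet_of_mem_wtSpace hy ?_, -t, ?_, by simpa using htt⟩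
  · rintro rfl
    simp at hxy
  · intro u
    simp [ht u]

theorem exists_toEnd_pow_eq_zero (h : IsEALA B H) {α : Module.Dual k H}
    (hα : α ∈ anisoRootSet B H) {x : E} (hx : x ∈ wtSpace H α) (v : E) :
    ∃ N : ℕ, (LieModule.toEnd k E E x ^ N) v = 0 := by
  obtain ⟨N, hN⟩ := h.ea2 α hα x hx v
  exact ⟨N, by rw [Module.End.pow_apply]; exact hN⟩

theorem mem_core_of_mem_wtSpace {α : Module.Dual k H} (hα : α ∈ anisoRootSet B H) {x : E}
    (hx : x ∈ wtSpace H α) : x ∈ core B H :=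
  LieSubalgebra.subset_lieSpan (Set.mem_biUnion hα hx)

/-- An ideal meeting some anisotropic root space nontrivially contains the core. -/
theorem core_le_of_mem (h : IsEALA B H) (I : LieIdeal k E) {α : Module.Dual k H}
    (hα : α ∈ anisoRootSet B H) {x : E} (hx : x ∈ wtSpace H α) (hx0 : x ≠ 0) (hxI : x ∈ I) :
    ∀ z ∈ core B H, z ∈ I := by
  have hrep : ∀ {β : Module.Dual k H} {z : E}, z ∈ wtSpace H β → z ≠ 0 → z ∈ I →
      ∀ {t : H}, t ∈ reps B H β → (t : E) ∈ I := by
    intro β z hz hz0 hzI t ht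
    obtain ⟨y, hy, hzy⟩ := h.exists_form_eq_one hz hz0
    rw [← h.lie_eq_of_mem_reps hz hy hzy ht]
    exact lie_mem_left k E I _ _ hzI
  have hmove : ∀ {t : H} {γ : Module.Dual k H}, (t : E) ∈ I → γ t ≠ 0 →
      ∀ z ∈ wtSpace H γ, z ∈ I := by
    intro t γ htI hγt z hz
    have h1 := I.smul_mem (γ t)⁻¹ (lie_mem_left k E I (t : E) z htI)
    rwa [hz t, smul_smul, inv_mul_cancel₀ hγt, one_smul] at h1
  have hall : ∀ γ ∈ anisoRootSet B H, ∀ z ∈ wtSpace H γ, z ∈ I := by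
    by_contra! hc
    obtain ⟨γ, hγ, z, hz, hzI⟩ := hc
    obtain ⟨β, ⟨hβ, hβI⟩, γ', ⟨hγ', hγ'I⟩, t, ht, s, hs, hts⟩ := h.ea3
      {β | β ∈ anisoRootSet B H ∧ ∀ z ∈ wtSpace H β, z ∈ I}
      {β | β ∈ anisoRootSet B H ∧ ¬ ∀ z ∈ wtSpace H β, z ∈ I}
      (by ext β; simp only [Set.mem_union, Set.mem_ofPred_eq]; tauto)
      (by
        obtain ⟨-, t, ht, htt⟩ := id hα
        exact ⟨α, hα, hmove (hrep hx hx0 hxI ht) (by rwa [← ht t])⟩)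
      ⟨γ, hγ, fun hall => hzI (hall z hz)⟩
    obtain ⟨w, hw, hw0⟩ := exists_ne_zero_of_mem_rootSet hβ.1
    exact hγ'I (hmove (hrep hw hw0 (hβI w hw) ht) (by rwa [← hs t, h.symm]))
  intro z hz
  unfold core at hz
  induction hz using LieSubalgebra.lieSpan_induction with
  | mem y hy =>
    obtain ⟨γ, hγ, hy⟩ := Set.mem_iUnion₂.mp hy
    exact hall γ hγ y hy
  | zero => exact I.zero_mem
  | add y z _ _ hy hz => exact I.add_mem hy hz
  | smul c y _ hy => exact I.smul_mem c hy
  | lie y z _ _ _ hz => exact lie_mem_right k E I _ _ hz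

variable [CharZero k]

/-- Roots are integral with respect to the coroots of anisotropic roots. -/
theorem exists_int_two_mul_apply (h : IsEALA B H) {α β : Module.Dual k H}
    (hα : α ∈ anisoRootSet B H) (hβ : β ∈ rootSet H) {t : H} (ht : t ∈ reps B H α) :
    ∃ m : ℤ, 2 * β t = m * B t t := by
  have htt : B t t ≠ 0 := by
    obtain ⟨-, s, hs, hss⟩ := hα
    rwa [h.eq_of_mem_reps ht hs]
  have hαt : α t = B t t := (ht t).symm
  obtain ⟨x, hx, hx0⟩ := exists_ne_zero_of_mem_rootSet hα.1
  obtain ⟨y, hy, hxy⟩ := h.exists_form_eq_one hx hx0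
  have hbr := h.lie_eq_of_mem_reps hx hy hxy ht
  set a : k := 2 * (B t t)⁻¹ with ha
  have haB : a * B t t = 2 := by rw [ha, mul_assoc, inv_mul_cancel₀ htt, mul_one]
  have hy' : a • y ∈ wtSpace H (-α) := Submodule.smul_mem _ _ hy
  have hsl : IsSl2Triple (a • (t : E)) x (a • y) :=
    { h_ne_zero := fun h0 => by
        have h1 : B (a • (t : E)) t = 0 := by rw [h0]; simp
        rw [map_smul, LinearMap.smul_apply, smul_eq_mul, haB] at h1
        exact two_ne_zero h1
      lie_e_f := by rw [lie_smul, hbr]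
      lie_h_e_nsmul := by
        rw [smul_lie, hx t, smul_smul, hαt, haB, ofNat_smul_eq_nsmul]
      lie_h_f_nsmul := by
        rw [smul_lie, hy' t, smul_smul, LinearMap.neg_apply, hαt, mul_neg, haB, neg_smul,
          ofNat_smul_eq_nsmul] }
  obtain ⟨v, hv, hv0⟩ := exists_ne_zero_of_mem_rootSet hβ
  obtain ⟨n, hn, hn'⟩ := Module.End.exists_pow_apply_ne_zero_and_succ_eq_zero _ hv0
    (h.exists_toEnd_pow_eq_zero hα hx v)
  have hw := toEnd_pow_mem_wtSpace hx hv n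
  set w := (LieModule.toEnd k E E x ^ n) v
  have P : hsl.HasPrimitiveVectorWith w (a * (n • α + β) t) :=
    { ne_zero := hn
      lie_h := by rw [smul_lie, hw t, smul_smul]
      lie_e := by
        rw [pow_succ', Module.End.mul_apply] at hn'
        exact hn' }
  obtain ⟨m, hm, hm'⟩ := Module.End.exists_pow_apply_ne_zero_and_succ_eq_zero _ hn
    (h.exists_toEnd_pow_eq_zero (h.neg_mem_anisoRootSet hα) hy' w)
  have h1 := P.lie_e_pow_succ_toEnd_f m
  rw [hm', lie_zero, eq_comm, smul_eq_zero] at h1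
  have h2 := (mul_eq_zero.mp (h1.resolve_right hm)).resolve_left
    (by exact_mod_cast m.succ_ne_zero)
  refine ⟨m - 2 * n, ?_⟩
  have h3 : a * β t = m - 2 * n := by
    rw [LinearMap.add_apply, LinearMap.smul_apply, nsmul_eq_mul, hαt] at h2
    linear_combination h2 - n * haB
  push_cast
  rw [← h3]
  linear_combination (-(β t)) * haB

/-- If `δ` is isotropic and `(α|δ) ≠ 0`, the `δ`-string through the root `α` is unbounded. -/
theorem exists_add_zsmul_mem_rootSet (h : IsEALA B H) {α δ : Module.Dual k H}
    (hα : α ∈ rootSet H) (hδ : δ ∈ rootSet H) {d : H} (hd : d ∈ reps B H δ)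
    (hdd : B d d = 0) (hαd : α d ≠ 0) (M : ℕ) :
    ∃ n : ℤ, M ≤ |n| ∧ α + n • δ ∈ rootSet H := by
  obtain ⟨x, hx, hx0⟩ := exists_ne_zero_of_mem_rootSet hδ
  obtain ⟨y, hy, hxy⟩ := h.exists_form_eq_one hx hx0
  have hbr := h.lie_eq_of_mem_reps hx hy hxy hd
  have hδd : δ d = 0 := by rw [← hd d, hdd]
  obtain ⟨v, hv, hv0⟩ := exists_ne_zero_of_mem_rootSet hα
  by_cases hnil : ∃ N : ℕ, (LieModule.toEnd k E E y ^ N) v = 0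
  · obtain ⟨N, hN, hN'⟩ := Module.End.exists_pow_apply_ne_zero_and_succ_eq_zero _ hv0 hnil
    have hw := toEnd_pow_mem_wtSpace hy hv N
    set w := (LieModule.toEnd k E E y ^ N) v
    have hne := heisenberg_pow_apply_ne_zero (LieModule.toEnd k E E x) (LieModule.toEnd k E E y)
      (LieModule.toEnd k E E (d : E)) (by ext u; simp [← hbr])
      (by
        have hxd : ⁅x, (d : E)⁆ = 0 := by rw [← lie_skew, hx d, hδd, zero_smul, neg_zero]
        ext u
        simp [leibniz_lie x (d : E) u, hxd])
      hαd hN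
      (by rwa [pow_succ', Module.End.mul_apply] at hN')
      (by
        have := hw d
        simpa [hδd] using this)
      (N + M)
    refine ⟨M, le_abs_self _, mem_rootSet_of_mem_wtSpace ?_ hne⟩
    convert toEnd_pow_mem_wtSpace hx hw (N + M) using 2
    module
  · push Not at hnil
    refine ⟨-M, by simp, mem_rootSet_of_mem_wtSpace ?_ (hnil M)⟩
    convert toEnd_pow_mem_wtSpace hy hv M using 2
    module

/-- Isotropic roots are orthogonal to anisotropic roots. -/
theorem apply_eq_zero_of_isotropic (h : IsEALA B H) {α δ : Module.Dual k H}
    (hα : α ∈ anisoRootSet B H) (hδ : δ ∈ rootSet H) {d : H} (hd : d ∈ reps B H δ)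
    (hdd : B d d = 0) : α d = 0 := by
  by_contra hαd
  obtain ⟨hαr, t, ht, htt⟩ := id hα
  obtain ⟨n, hn, hnr⟩ := h.exists_add_zsmul_mem_rootSet hαr hδ hd hdd hαd 3
  obtain ⟨m, hm⟩ := h.exists_int_two_mul_apply hα hδ ht
  have hδt : δ t = α d := h.apply_eq_apply ht hd
  have hm0 : m ≠ 0 := by
    rintro rfl
    simp [hδt, hαd] at hm
  have hlt : |m| < |1 + n * m| := by
    have h1 : |n * m| ≤ |1 + n * m| + 1 := by
      have := abs_sub (1 + n * m) 1
      simpa using this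
    rw [abs_mul] at h1
    have := Int.one_le_abs hm0
    push_cast at hn
    nlinarith
  have hβ := add_mem_reps ht (zsmul_mem_reps hd n)
  have hnorm : B (t + n • d : H) (t + n • d : H) = (1 + n * m : ℤ) * B t t := by
    have h1 : B t d = α d := ht d
    have h2 : B d t = α d := (hd t).trans hδt
    rw [hδt] at hm
    simp only [AddMemClass.coe_add, AddSubgroupClass.coe_zsmul, map_add, map_zsmul,
      LinearMap.add_apply, LinearMap.smul_apply, h1, h2, hdd]
    simp
    linear_combination (n : k) * hm
  have h1m : (1 + n * m) ≠ 0 := fun h0 => by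
    rw [h0, abs_zero] at hlt
    exact (abs_nonneg m).not_gt hlt
  have haniso : α + n • δ ∈ anisoRootSet B H :=
    ⟨hnr, _, hβ, by rw [hnorm]; exact mul_ne_zero (Int.cast_ne_zero.mpr h1m) htt⟩
  obtain ⟨m', hm'⟩ := h.exists_int_two_mul_apply haniso hδ hβ
  have hδd : δ d = 0 := by rw [← hd d, hdd]
  rw [hnorm, map_add, map_zsmul, hδd, smul_zero, add_zero, hm, ← mul_assoc] at hm'
  have hdvd : m = m' * (1 + n * m) := by exact_mod_cast mul_right_cancel₀ htt hm'
  refine hm0 (Int.eq_zero_of_abs_lt_dvd ((abs_dvd _ _).mpr ⟨m', ?_⟩) hlt)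
  rw [mul_comm]
  exact hdvd

theorem add_mem_anisoRootSet (h : IsEALA B H) {α δ : Module.Dual k H}
    (hα : α ∈ anisoRootSet B H) (hδ : δ ∈ rootSet H) (hδ' : δ ∉ anisoRootSet B H)
    (hr : δ + α ∈ rootSet H) : δ + α ∈ anisoRootSet B H := by
  obtain ⟨d, hd⟩ := h.exists_mem_reps hδ
  have hdd : B d d = 0 := by
    by_contra hc
    exact hδ' ⟨hδ, d, hd, hc⟩
  have h0 := h.apply_eq_zero_of_isotropic hα hδ hd hdd
  obtain ⟨-, t, ht, htt⟩ := hα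
  refine ⟨hr, _, add_mem_reps hd ht, ?_⟩
  have h1 : B t d = 0 := (ht d).trans h0
  have h2 : B d t = 0 := (h.symm _ _).trans h1
  simpa [hdd, h1, h2] using htt

theorem lie_mem_core (h : IsEALA B H) (e : E) {x : E} (hx : x ∈ core B H) :
    ⁅e, x⁆ ∈ core B H := by
  have he : e ∈ ⨆ β : Module.Dual k H, wtSpace H β := h.toral ▸ Submodule.mem_top
  induction he using Submodule.iSup_induction' with
  | zero => simp
  | add y z _ _ hy hz =>
    rw [add_lie]
    exact add_mem hy hz
  | mem δ e he =>
    by_cases hδ : δ ∈ anisoRootSet B H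
    · exact (core B H).lie_mem (mem_core_of_mem_wtSpace hδ he) hx
    · unfold core at hx
      induction hx using LieSubalgebra.lieSpan_induction with
      | mem y hy =>
        obtain ⟨α, hα, hy⟩ := Set.mem_iUnion₂.mp hy
        by_cases h0 : ⁅e, y⁆ = 0
        · rw [h0]
          exact zero_mem _
        · have he0 : e ≠ 0 := by
            rintro rfl
            simp at h0
          have hmem := lie_mem_wtSpace_add he hy
          exact mem_core_of_mem_wtSpace (h.add_mem_anisoRootSet hα (mem_rootSet_of_mem_wtSpace he he0) hδ
            (mem_rootSet_of_mem_wtSpace hmem h0)) hmem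
      | zero => simp
      | add y z _ _ hy hz =>
        rw [lie_add]
        exact add_mem hy hz
      | smul c y _ hy =>
        rw [lie_smul]
        exact (core B H).smul_mem c hy
      | lie y z hy hz hy' hz' =>
        rw [leibniz_lie]
        exact add_mem ((core B H).lie_mem hy' hz) ((core B H).lie_mem hy hz')

/-- An ideal meeting every anisotropic root space trivially centralizes the core. -/
theorem lie_eq_zero_of_ideal (h : IsEALA B H) (I : LieIdeal k E)
    (hI : ∀ α ∈ anisoRootSet B H, ∀ x ∈ wtSpace H α, x ∈ I → x = 0) {x : E} (hx : x ∈ I)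
    {z : E} (hz : z ∈ core B H) : ⁅x, z⁆ = 0 := by
  unfold core at hz
  induction hz using LieSubalgebra.lieSpan_induction with
  | mem z hz =>
    obtain ⟨α, hα, hz⟩ := Set.mem_iUnion₂.mp hz
    have htop : x ∈ ⨆ β : Module.Dual k H, wtSpace H β := h.toral ▸ Submodule.mem_top
    obtain ⟨u, hu, rfl⟩ := (Submodule.mem_iSup_iff_exists_finsupp _ _).mp htop
    have huI := mem_of_sum_wtSpace_mem I u.support u (fun β _ => hu β) hx
    rw [Finsupp.sum, sum_lie]
    refine Finset.sum_eq_zero fun δ hδ => ?_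
    by_contra h0
    have hu0 : u δ ≠ 0 := Finsupp.mem_support_iff.mp hδ
    have hδr := mem_rootSet_of_mem_wtSpace (hu δ) hu0
    have hmem := lie_mem_wtSpace_add (hu δ) hz
    exact h0 (hI _ (h.add_mem_anisoRootSet hα hδr
      (fun hδa => hu0 (hI δ hδa _ (hu δ) (huI δ hδ)))
      (mem_rootSet_of_mem_wtSpace hmem h0)) _ hmem (lie_mem_left k E I _ _ (huI δ hδ)))
  | zero => simp
  | add y z _ _ hy hz => rw [lie_add, hy, hz, add_zero]
  | smul c y _ hy => rw [lie_smul, hy, smul_zero]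
  | lie y z _ _ hy hz => rw [leibniz_lie, hy, hz, zero_lie, lie_zero, add_zero]

/-- Automorphisms map the core into itself. -/
theorem map_mem_core (h : IsEALA B H) (f : E ≃ₗ⁅k⁆ E) {z : E} (hz : z ∈ core B H) :
    f z ∈ core B H := by
  let C : LieIdeal k E := { (core B H).toSubmodule with lie_mem := fun {e _} => h.lie_mem_core e }
  let I : LieIdeal k E := C.comap (f : E →ₗ⁅k⁆ E)
  have hI : ∀ {x}, x ∈ I ↔ f x ∈ core B H := by
    intro x
    rw [LieIdeal.mem_comap]
    rfl
  by_cases hmeet : ∀ α ∈ anisoRootSet B H, ∀ x ∈ wtSpace H α, x ∈ I → x = 0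
  · have hcent : ∀ x, f x ∈ core B H → ∀ y ∈ core B H, ⁅x, y⁆ = 0 := fun x hx y hy =>
      h.lie_eq_zero_of_ideal I hmeet (hI.mpr hx) hy
    have hab : ∀ x, f x ∈ core B H → ∀ y, f y ∈ core B H → ⁅x, y⁆ = 0 := fun x hx y hy =>
      hcent x hx y (h.ea4 y (hcent y hy))
    have hempty : anisoRootSet B H = ∅ := by
      refine Set.eq_empty_of_forall_notMem fun α hα => ?_
      obtain ⟨hr, t, ht, htt⟩ := id hα
      obtain ⟨x, hx, hx0⟩ := exists_ne_zero_of_mem_rootSet hr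
      obtain ⟨y, hy, hxy⟩ := h.exists_form_eq_one hx hx0
      have h0 := hab (f.symm x) (by simpa using mem_core_of_mem_wtSpace hα hx) (f.symm y)
        (by simpa using mem_core_of_mem_wtSpace (h.neg_mem_anisoRootSet hα) hy)
      rw [← LieEquiv.map_lie, h.lie_eq_of_mem_reps hx hy hxy ht] at h0
      have ht0 : (t : E) = 0 := by
        have := congrArg f h0
        simpa using this
      simp [ht0] at htt
    have hz0 : z = 0 := by simpa [core, hempty] using hz
    simp [hz0]
  · push Not at hmeet
    obtain ⟨α, hα, x, hx, hxI, hx0⟩ := hmeet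
    exact hI.mp (h.core_le_of_mem I hα hx hx0 hxI z hz)

end IsEALA

/-- Proposition 3.4 of the paper: the core of an EALA `(E,H,(·|·))` is
stable under every automorphism of the Lie algebra `E`: `f(E_c) = E_c`. -/
theorem eala_core_stable_under_automorphisms
    {k E : Type*} [Field k] [CharZero k] [LieRing E] [LieAlgebra k E]
    (B : E →ₗ[k] E →ₗ[k] k) (H : LieSubalgebra k E) (h : IsEALA B H)
    (f : E ≃ₗ⁅k⁆ E) :
    f '' (core B H : Set E) = (core B H : Set E) := by
  refine Set.Subset.antisymm ?_ fun z hz => ⟨f.symm z, h.map_mem_core f.symm hz, by simp⟩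
  rintro _ ⟨z, hz, rfl⟩
  exact h.map_mem_core f hz
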